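/- Fractional Gronwall inequality: Let α ∈ (0,1), c ≥ 0, and let ȳ, y : (0,1] → ℝ be continuous functions such that ζ ↦ ζ^(1−α) ȳ(ζ) and ζ ↦ ζ^(1−α) y(ζ) are bounded. If y(ϑ) ≤ ȳ(ϑ) + (c/Γ(α)) ∫₀^ϑ y(ζ) (ϑ−ζ)^(α−1) dζ for all ϑ ∈ (0,1], then y(ϑ) ≤ ȳ(ϑ) + c ∫₀^ϑ E_{α,α}(c(ϑ−ζ)^α) ȳ(ζ) (ϑ−ζ)^(α−1) dζ for all ϑ ∈ (0,1], where E_{α,α}(z) = ∑_{k≥0} z^k / Γ(αk + α) is the two-parameter Mittag–Leffler function. -/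

import Mathlib

open MeasureTheory Real Set Filter

noncomputable def mittagLeffler (α z : ℝ) : ℝ := ∑' k : ℕ, z ^ k / Real.Gamma (α * (k + 1))

open Topology in
theorem ml_summable (α z : ℝ) (hα : α ∈ Set.Ioo (0:ℝ) 1) (hz : 0 ≤ z) :
    Summable (fun k : ℕ => z ^ k / Real.Gamma (α * (k + 1))) := by
  obtain ⟨h0, h1⟩ := hα
  have hG : ∀ k : ℕ, 0 < Real.Gamma (α * (k + 1)) := fun k => Real.Gamma_pos_of_pos (by positivity)
  rcases hz.eq_or_lt with rfl | hz
  · refine summable_of_ne_finset_zero (s := {0}) ?_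
    intro b hb
    have : b ≠ 0 := by simpa using hb
    simp [this]
  refine summable_of_ratio_test_tendsto_lt_one (l := 0) one_pos ?_ ?_
  · exact Eventually.of_forall fun k => (div_pos (pow_pos hz k) (hG k)).ne'
  have key : ∀ x : ℝ, 1 < x → Real.Gamma x / Real.Gamma (x + α) ≤ (x + α - 1) ^ (-α) := by
    intro x hx
    have hp : 0 < x + α - 1 := by linarith
    have hg1 := Real.Gamma_pos_of_pos hp
    have hg2 : 0 < Real.Gamma (x + α) := Real.Gamma_pos_of_pos (by linarith)
    have h := Real.Gamma_mul_add_mul_le_rpow_Gamma_mul_rpow_Gamma (s := x + α - 1) (t := x + α)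
      (a := α) (b := 1 - α) hp (by linarith) h0 (by linarith) (by ring)
    rw [show α * (x + α - 1) + (1 - α) * (x + α) = x by ring] at h
    have h2 : Real.Gamma (x + α) = (x + α - 1) * Real.Gamma (x + α - 1) := by
      rw [← Real.Gamma_add_one hp.ne']; ring_nf
    rw [div_le_iff₀ hg2]
    refine h.trans (le_of_eq ?_)
    rw [h2, Real.mul_rpow hp.le hg1.le]
    have e1 : Real.Gamma (x + α - 1) ^ α * Real.Gamma (x + α - 1) ^ (1 - α) = Real.Gamma (x + α - 1) := by
      rw [← Real.rpow_add hg1]; simp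
    have e2 : (x + α - 1) ^ (1 - α) = (x + α - 1) ^ (-α) * (x + α - 1) := by
      nth_rewrite 3 [← Real.rpow_one (x + α - 1)]
      rw [← Real.rpow_add hp]; ring_nf
    rw [e2]
    linear_combination ((x + α - 1) ^ (-α) * (x + α - 1)) * e1
  have hx : Tendsto (fun n : ℕ => α * ((n:ℝ) + 1)) atTop atTop :=
    (tendsto_atTop_add_const_right _ 1 tendsto_natCast_atTop_atTop).const_mul_atTop h0
  have hlim : Tendsto (fun n : ℕ => z * (α * ((n:ℝ) + 1) + α - 1) ^ (-α)) atTop (𝓝 0) := by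
    have : Tendsto (fun n : ℕ => α * ((n:ℝ) + 1) + α - 1) atTop atTop := by
      simpa [add_sub_assoc] using tendsto_atTop_add_const_right _ (α - 1) hx
    simpa using ((tendsto_rpow_neg_atTop h0).comp this).const_mul z
  refine squeeze_zero' (Eventually.of_forall fun n => by positivity) ?_ hlim
  filter_upwards [hx.eventually_gt_atTop 1] with n hn
  have hk := key _ hn
  have e : α * (((n + 1 : ℕ):ℝ) + 1) = α * ((n:ℝ) + 1) + α := by push_cast; ring
  rw [Real.norm_of_nonneg (div_pos (pow_pos hz _) (hG _)).le,
    Real.norm_of_nonneg (div_pos (pow_pos hz _) (hG _)).le]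
  rw [e]
  have hg := hG n
  have hg' := hG (n+1)
  rw [e] at hg'
  calc _ = z * (Real.Gamma (α * ((n:ℝ) + 1)) / Real.Gamma (α * ((n:ℝ) + 1) + α)) := by
        field_simp
        ring
    _ ≤ _ := by gcongr

noncomputable def kern (β t : ℝ) : ℝ := if 0 < t then t ^ (β - 1) / Real.Gamma β else 0

theorem kern_meas (β : ℝ) : Measurable (kern β) :=
  Measurable.ite measurableSet_Ioi (by fun_prop) (by fun_prop)

theorem kern_nonneg {β : ℝ} (hβ : 0 < β) (t : ℝ) : 0 ≤ kern β t := by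
  have := Real.Gamma_pos_of_pos hβ
  unfold kern; split_ifs <;> positivity

theorem real_beta {a b T : ℝ} (ha : 0 < a) (hb : 0 < b) (hT : 0 < T) :
    ∫ x in (0:ℝ)..T, x ^ (a - 1) * (T - x) ^ (b - 1) =
      T ^ (a + b - 1) * (Real.Gamma a * Real.Gamma b / Real.Gamma (a + b)) := by
  have h := Complex.betaIntegral_scaled a b hT
  have h2 := Complex.Gamma_mul_Gamma_eq_betaIntegral (s := a) (t := b) (by simpa) (by simpa)
  have hg := Real.Gamma_pos_of_pos (add_pos ha hb)
  have h3 : Complex.betaIntegral a b = ((Real.Gamma a * Real.Gamma b / Real.Gamma (a + b) : ℝ) : ℂ) := by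
    rw [← Complex.ofReal_add, Complex.Gamma_ofReal, Complex.Gamma_ofReal, Complex.Gamma_ofReal] at h2
    have : (Real.Gamma (a + b) : ℂ) ≠ 0 := by exact_mod_cast hg.ne'
    push_cast
    rw [h2]; field_simp
  rw [h3] at h
  apply Complex.ofReal_injective
  rw [← intervalIntegral.integral_ofReal]
  push_cast at h ⊢
  rw [Complex.ofReal_cpow hT.le]
  push_cast
  rw [← h]
  refine intervalIntegral.integral_congr fun x hx => ?_
  rw [uIcc_of_le hT.le] at hx
  rw [Complex.ofReal_cpow hx.1, Complex.ofReal_cpow (by linarith [hx.2])]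
  push_cast; rfl

theorem kern_conv {a b : ℝ} (ha : 0 < a) (hb : 0 < b) (T : ℝ) :
    ∫ s, kern b (T - s) * kern a s = kern (a + b) T := by
  rcases le_or_gt T 0 with hT | hT
  · have : ∀ s, kern b (T - s) * kern a s = 0 := by
      intro s
      unfold kern
      by_cases h : 0 < s
      · simp [show ¬ (0 < T - s) by linarith]
      · simp [h]
    simp_rw [this]; simp [kern, hT.not_gt]
  · have : (fun s => kern b (T - s) * kern a s) = (Ioo 0 T).indicator
        (fun s => (Real.Gamma a * Real.Gamma b)⁻¹ * (s ^ (a - 1) * (T - s) ^ (b - 1))) := by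
      ext s
      unfold kern
      by_cases h : 0 < s <;> by_cases h' : s < T <;> simp [h, h', indicator]
      ring
    rw [this, integral_indicator measurableSet_Ioo, ← integral_Ioc_eq_integral_Ioo,
      ← intervalIntegral.integral_of_le hT.le, intervalIntegral.integral_const_mul,
      real_beta ha hb hT, kern, if_pos hT]
    have := Real.Gamma_pos_of_pos ha
    have := Real.Gamma_pos_of_pos hb
    field_simp

theorem kern_int {a b : ℝ} (ha : 0 < a) (hb : 0 < b) (T : ℝ) :
    Integrable (fun s => kern b (T - s) * kern a s) := by
  rcases le_or_gt T 0 with hT | hT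
  · have : (fun s => kern b (T - s) * kern a s) = fun _ => 0 := by
      ext s
      unfold kern
      by_cases h : 0 < s
      · simp [show ¬ (0 < T - s) by linarith]
      · simp [h]
    rw [this]; exact integrable_zero _ _ _
  · apply Integrable.of_integral_ne_zero
    rw [kern_conv ha hb, kern, if_pos hT]
    have := Real.Gamma_pos_of_pos (add_pos ha hb)
    positivity

theorem kern_conv' {a b : ℝ} (ha : 0 < a) (hb : 0 < b) (T z : ℝ) :
    ∫ s, kern b (T - s) * kern a (s - z) = kern (a + b) (T - z) := by
  rw [← kern_conv ha hb,
    ← integral_sub_right_eq_self (fun s => kern b (T - z - s) * kern a s) z]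
  simp

theorem kern_int' {a b : ℝ} (ha : 0 < a) (hb : 0 < b) (T z : ℝ) :
    Integrable (fun s => kern b (T - s) * kern a (s - z)) := by
  have := (kern_int ha hb (T - z)).comp_sub_right z
  simpa using this

theorem J_int {a b K : ℝ} (ha : 0 < a) (hb : 0 < b) {f : ℝ → ℝ} (hf : Measurable f)
    (hK : ∀ s, |f s| ≤ K * kern a s) (T : ℝ) :
    Integrable (fun s => kern b (T - s) * f s) := by
  have hm := kern_meas b
  refine ((kern_int ha hb T).const_mul K).mono' (by fun_prop) (Eventually.of_forall fun s => ?_)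
  rw [norm_mul, Real.norm_of_nonneg (kern_nonneg hb _), Real.norm_eq_abs]
  calc _ ≤ kern b (T - s) * (K * kern a s) := mul_le_mul_of_nonneg_left (hK s) (kern_nonneg hb _)
    _ = _ := by ring

theorem J_bound {a b K : ℝ} (ha : 0 < a) (hb : 0 < b) {f : ℝ → ℝ} (hf : Measurable f)
    (hK : ∀ s, |f s| ≤ K * kern a s) (T : ℝ) :
    ∫ s, ‖kern b (T - s) * f s‖ ≤ K * kern (a + b) T := by
  rw [← kern_conv ha hb, ← integral_const_mul]
  refine integral_mono (J_int ha hb hf hK T).norm ((kern_int ha hb T).const_mul K) fun s => ?_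
  simp only
  rw [norm_mul, Real.norm_of_nonneg (kern_nonneg hb _), Real.norm_eq_abs]
  calc _ ≤ kern b (T - s) * (K * kern a s) := mul_le_mul_of_nonneg_left (hK s) (kern_nonneg hb _)
    _ = _ := by ring

theorem J_prod {a b d K : ℝ} (ha : 0 < a) (hb : 0 < b) (hd : 0 < d) {f : ℝ → ℝ} (hf : Measurable f)
    (hK : ∀ s, |f s| ≤ K * kern d s) (T : ℝ) :
    Integrable (Function.uncurry fun s z => kern b (T - s) * (kern a (s - z) * f z))
      ((volume : Measure ℝ).prod volume) := by
  have hma := kern_meas a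
  have hmb := kern_meas b
  rw [integrable_prod_iff' (by unfold Function.uncurry; fun_prop)]
  constructor
  · refine Eventually.of_forall fun z => ?_
    simpa [Function.uncurry, mul_assoc] using (kern_int' ha hb T z).mul_const (f z)
  · have : (fun z => ∫ s, ‖Function.uncurry (fun s z => kern b (T - s) * (kern a (s - z) * f z)) (s, z)‖)
        = fun z => ‖kern (a + b) (T - z) * f z‖ := by
      ext z
      rw [norm_mul, Real.norm_of_nonneg (kern_nonneg (add_pos ha hb) _), ← kern_conv' ha hb,
        ← integral_mul_const]
      congr 1; ext s
      simp only [Function.uncurry]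
      rw [norm_mul, norm_mul, Real.norm_of_nonneg (kern_nonneg hb _),
        Real.norm_of_nonneg (kern_nonneg ha _)]
      ring
    rw [this]
    exact (J_int hd (add_pos ha hb) hf hK T).norm

theorem J_semi {a b d K : ℝ} (ha : 0 < a) (hb : 0 < b) (hd : 0 < d) {f : ℝ → ℝ} (hf : Measurable f)
    (hK : ∀ s, |f s| ≤ K * kern d s) (T : ℝ) :
    ∫ s, kern b (T - s) * ∫ z, kern a (s - z) * f z = ∫ z, kern (a + b) (T - z) * f z := by
  simp_rw [← integral_const_mul]
  rw [integral_integral_swap (J_prod ha hb hd hf hK T)]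
  congr 1; ext z
  rw [← kern_conv' ha hb, ← integral_mul_const]
  simp_rw [mul_assoc]

theorem J_semi_int {a b d K : ℝ} (ha : 0 < a) (hb : 0 < b) (hd : 0 < d) {f : ℝ → ℝ}
    (hf : Measurable f) (hK : ∀ s, |f s| ≤ K * kern d s) (T : ℝ) :
    Integrable fun s => kern b (T - s) * ∫ z, kern a (s - z) * f z := by
  simpa [Function.uncurry, integral_const_mul] using (J_prod ha hb hd hf hK T).integral_prod_left

theorem ext_meas {y : ℝ → ℝ} (hy : ContinuousOn y (Set.Ioc 0 1)) :
    Measurable ((Ioc (0:ℝ) 1).indicator y) := by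
  classical
  rw [← Set.piecewise_eq_indicator]
  exact hy.measurable_piecewise continuousOn_const measurableSet_Ioc

theorem ext_bdd {α : ℝ} (h0 : 0 < α) {y : ℝ → ℝ}
    (h : ∃ K, ∀ ζ ∈ Set.Ioc (0:ℝ) 1, |ζ ^ (1 - α) * y ζ| ≤ K) :
    ∃ K, ∀ s, |(Ioc (0:ℝ) 1).indicator y s| ≤ K * kern α s := by
  obtain ⟨K, hK⟩ := h
  have hK0 : 0 ≤ K := (abs_nonneg _).trans (hK 1 (by simp))
  have hg := Real.Gamma_pos_of_pos h0
  refine ⟨K * Real.Gamma α, fun s => ?_⟩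
  by_cases hs : s ∈ Ioc (0:ℝ) 1
  · rw [indicator_of_mem hs, kern, if_pos hs.1]
    have h1 := hK s hs
    have hp : 0 < s ^ (1 - α) := Real.rpow_pos_of_pos hs.1 _
    rw [abs_mul, abs_of_pos hp] at h1
    have e : s ^ (α - 1) = (s ^ (1 - α))⁻¹ := by
      rw [← Real.rpow_neg hs.1.le]; ring_nf
    rw [e]
    calc |y s| = (s ^ (1 - α) * |y s|) * (s ^ (1 - α))⁻¹ := by field_simp
      _ ≤ K * (s ^ (1 - α))⁻¹ := by gcongr
      _ = _ := by field_simp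
  · rw [indicator_of_notMem hs, abs_zero]
    have := kern_nonneg h0 s
    positivity

theorem J_zero {a T : ℝ} (hT : T ≤ 0) (y : ℝ → ℝ) :
    ∫ z, kern a (T - z) * (Ioc (0:ℝ) 1).indicator y z = 0 := by
  have : ∀ z, kern a (T - z) * (Ioc (0:ℝ) 1).indicator y z = 0 := by
    intro z
    by_cases hz : z ∈ Ioc (0:ℝ) 1
    · simp [kern, show ¬ (z < T) by linarith [hz.1]]
    · simp [hz]
  simp [this]

theorem J_eq {g : ℝ → ℝ} {T : ℝ} (hT : T ∈ Ioc (0:ℝ) 1) (y G : ℝ → ℝ)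
    (hG : ∀ t ≤ 0, G t = 0) (hg : ∀ z ∈ Ioo 0 T, G (T - z) * y z = g z) :
    ∫ z in (0:ℝ)..T, g z = ∫ z, G (T - z) * (Ioc (0:ℝ) 1).indicator y z := by
  rw [intervalIntegral.integral_of_le hT.1.le, integral_Ioc_eq_integral_Ioo,
    ← integral_indicator measurableSet_Ioo]
  congr 1; ext z
  by_cases hz : z ∈ Ioo 0 T
  · rw [indicator_of_mem hz, ← hg z hz, indicator_of_mem (show z ∈ Ioc (0:ℝ) 1 from ⟨hz.1, hz.2.le.trans hT.2⟩)]
  · rw [indicator_of_notMem hz]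
    by_cases h : 0 < z
    · have : T ≤ z := by by_contra hh; exact hz ⟨h, not_le.1 hh⟩
      rw [hG _ (by linarith), zero_mul]
    · rw [indicator_of_notMem (fun hh => h hh.1), mul_zero]

theorem stmt_6 (α c : ℝ) (hα : α ∈ Set.Ioo (0:ℝ) 1) (hc : 0 ≤ c)
    (ybar y : ℝ → ℝ)
    (hybar_cont : ContinuousOn ybar (Set.Ioc 0 1))
    (hy_cont : ContinuousOn y (Set.Ioc 0 1))
    (hybar_bdd : ∃ K, ∀ ζ ∈ Set.Ioc (0:ℝ) 1, |ζ ^ (1 - α) * ybar ζ| ≤ K)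
    (hy_bdd : ∃ K, ∀ ζ ∈ Set.Ioc (0:ℝ) 1, |ζ ^ (1 - α) * y ζ| ≤ K)
    (hineq : ∀ ϑ ∈ Set.Ioc (0:ℝ) 1,
      y ϑ ≤ ybar ϑ + (c / Real.Gamma α) * ∫ ζ in (0:ℝ)..ϑ, y ζ * (ϑ - ζ) ^ (α - 1)) :
    ∀ ϑ ∈ Set.Ioc (0:ℝ) 1,
      y ϑ ≤ ybar ϑ +
        c * ∫ ζ in (0:ℝ)..ϑ, mittagLeffler α (c * (ϑ - ζ) ^ α) * ybar ζ * (ϑ - ζ) ^ (α - 1) := by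
  have h0 := hα.1
  have hg := Real.Gamma_pos_of_pos h0
  obtain ⟨K, hK⟩ := ext_bdd h0 hy_bdd
  obtain ⟨L, hL⟩ := ext_bdd h0 hybar_bdd
  have hmy := ext_meas hy_cont
  have hmb := ext_meas hybar_cont
  -- the inequality in kernel form
  have hineq' : ∀ s ≤ 1, (Ioc (0:ℝ) 1).indicator y s ≤ (Ioc (0:ℝ) 1).indicator ybar s +
      c * ∫ z, kern α (s - z) * (Ioc (0:ℝ) 1).indicator y z := by
    intro s hs
    rcases le_or_gt s 0 with h | h
    · rw [J_zero h, indicator_of_notMem (fun hh => h.not_gt hh.1),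
        indicator_of_notMem (fun hh => h.not_gt hh.1)]
      simp
    · have hm : s ∈ Ioc (0:ℝ) 1 := ⟨h, hs⟩
      rw [indicator_of_mem hm, indicator_of_mem hm]
      refine (hineq s ⟨h, hs⟩).trans (le_of_eq ?_)
      rw [← J_eq (g := fun z => (Real.Gamma α)⁻¹ * (y z * (s - z) ^ (α - 1))) ⟨h, hs⟩ y (kern α)
        (fun t ht => by simp [kern, ht.not_gt])
        (fun z hz => by rw [kern, if_pos (by linarith [hz.2])]; field_simp),
        intervalIntegral.integral_const_mul]
      ring
  intro T hT
  have hpos : ∀ n : ℕ, 0 < α * ((n:ℝ) + 1) := fun n => by positivity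
  have iter : ∀ n : ℕ, y T ≤ ybar T + ∑ k ∈ Finset.range n,
      (∫ z, c ^ (k + 1) * (kern (α * ((k:ℝ) + 1)) (T - z) * (Ioc (0:ℝ) 1).indicator ybar z)) +
      c ^ (n + 1) * ∫ z, kern (α * ((n:ℝ) + 1)) (T - z) * (Ioc (0:ℝ) 1).indicator y z := by
    intro n
    induction n with
    | zero =>
      have := hineq' T hT.2
      rw [indicator_of_mem hT, indicator_of_mem hT] at this
      simpa using this
    | succ n ih =>
      refine ih.trans ?_
      have hb := hpos n
      have hstep : ∫ z, kern (α * ((n:ℝ) + 1)) (T - z) * (Ioc (0:ℝ) 1).indicator y z ≤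
          (∫ z, kern (α * ((n:ℝ) + 1)) (T - z) * (Ioc (0:ℝ) 1).indicator ybar z) +
          c * ∫ z, kern (α * (((n + 1 : ℕ):ℝ) + 1)) (T - z) * (Ioc (0:ℝ) 1).indicator y z := by
        have e : α * (((n + 1 : ℕ):ℝ) + 1) = α + α * ((n:ℝ) + 1) := by push_cast; ring
        rw [e, ← J_semi h0 hb h0 hmy hK, ← integral_const_mul, ← integral_add
          (J_int h0 hb hmb hL T) ((J_semi_int h0 hb h0 hmy hK T).const_mul c)]
        refine integral_mono (J_int h0 hb hmy hK T) ((J_int h0 hb hmb hL T).add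
          ((J_semi_int h0 hb h0 hmy hK T).const_mul c)) fun s => ?_
        simp only [Pi.add_apply]
        rcases le_or_gt s 1 with h | h
        · calc _ ≤ kern (α * ((n:ℝ) + 1)) (T - s) * _ :=
                mul_le_mul_of_nonneg_left (hineq' s h) (kern_nonneg hb _)
            _ = _ := by ring
        · have : kern (α * ((n:ℝ) + 1)) (T - s) = 0 := by
            rw [kern, if_neg]; linarith [hT.2]
          simp [this]
      rw [Finset.sum_range_succ, integral_const_mul (c ^ (n + 1))]
      have := mul_le_mul_of_nonneg_left hstep (pow_nonneg hc (n + 1))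
      rw [pow_succ c (n + 1)]
      linarith
  have hz : 0 ≤ c * T ^ α := mul_nonneg hc (Real.rpow_nonneg hT.1.le _)
  have hkern : ∀ (n : ℕ) (t : ℝ), 0 < t → c ^ n * kern (α * ((n:ℝ) + 1)) t =
      t ^ (α - 1) * ((c * t ^ α) ^ n / Real.Gamma (α * ((n:ℝ) + 1))) := by
    intro n t ht
    rw [kern, if_pos ht, show α * ((n:ℝ) + 1) - 1 = (α - 1) + α * n by ring, Real.rpow_add ht,
      Real.rpow_mul ht.le, Real.rpow_natCast, mul_pow]
    ring
  have hsum : Summable fun n : ℕ => c ^ (n + 1) * kern (α + α * ((n:ℝ) + 1)) T := by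
    have h := ((ml_summable α _ hα hz).mul_left (T ^ (α - 1)))
    simp_rw [← hkern _ T hT.1] at h
    have h' := (summable_nat_add_iff 1).2 h
    refine h'.congr fun n => ?_
    push_cast; ring_nf
  -- remainder
  have hrem : Tendsto (fun n : ℕ => c ^ (n + 1) *
      ∫ z, kern (α * ((n:ℝ) + 1)) (T - z) * (Ioc (0:ℝ) 1).indicator y z) atTop (nhds 0) := by
    have h := hsum.tendsto_atTop_zero.const_mul K
    rw [mul_zero] at h
    refine squeeze_zero_norm (fun n => ?_) h
    rw [norm_mul, Real.norm_of_nonneg (pow_nonneg hc _)]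
    calc _ ≤ c ^ (n + 1) * (K * kern (α + α * ((n:ℝ) + 1)) T) :=
          mul_le_mul_of_nonneg_left ((norm_integral_le_integral_norm _).trans
            (J_bound h0 (hpos n) hmy hK T)) (pow_nonneg hc _)
      _ = _ := by ring
  have hser := hasSum_integral_of_summable_integral_norm (μ := (volume : Measure ℝ))
    (F := fun (k : ℕ) z => c ^ (k + 1) * (kern (α * ((k:ℝ) + 1)) (T - z) *
      (Ioc (0:ℝ) 1).indicator ybar z))
    (fun k => (J_int h0 (hpos k) hmb hL T).const_mul _)
    (by
      refine Summable.of_nonneg_of_le (fun k => integral_nonneg fun _ => norm_nonneg _) (fun k => ?_)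
        (hsum.mul_left L)
      simp_rw [norm_mul (c ^ (k + 1)), integral_const_mul, Real.norm_of_nonneg (pow_nonneg hc (k+1))]
      calc _ ≤ c ^ (k + 1) * (L * kern (α + α * ((k:ℝ) + 1)) T) :=
            mul_le_mul_of_nonneg_left (J_bound h0 (hpos k) hmb hL T) (pow_nonneg hc _)
        _ = _ := by ring)
  have hfin : ∫ z, (∑' k : ℕ, c ^ (k + 1) * (kern (α * ((k:ℝ) + 1)) (T - z) *
      (Ioc (0:ℝ) 1).indicator ybar z)) =
      c * ∫ ζ in (0:ℝ)..T, mittagLeffler α (c * (T - ζ) ^ α) * ybar ζ * (T - ζ) ^ (α - 1) := by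
    rw [← intervalIntegral.integral_const_mul, J_eq hT ybar
      (fun t => ∑' k : ℕ, c ^ (k + 1) * kern (α * ((k:ℝ) + 1)) t)
      (fun t ht => by simp [kern, ht.not_gt])]
    · congr 1; ext z
      rw [← tsum_mul_right]
      simp_rw [mul_assoc]
    · intro z hz
      have ht : 0 < T - z := by linarith [hz.2]
      have : ∀ k : ℕ, c ^ (k + 1) * kern (α * ((k:ℝ) + 1)) (T - z) = c * (T - z) ^ (α - 1) *
          ((c * (T - z) ^ α) ^ k / Real.Gamma (α * ((k:ℝ) + 1))) := by
        intro k
        rw [mul_assoc, ← hkern k _ ht]; ring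
      simp only [this]
      rw [tsum_mul_left, mittagLeffler]
      ring
  rw [← hfin]
  have hlim := (hser.tendsto_sum_nat.const_add (ybar T)).add hrem
  rw [add_zero] at hlim
  exact ge_of_tendsto' hlim iter
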